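/- Let m ≥ 1 and n_1,…,n_m be positive integers, and let x_1,…,x_m be complex numbers. Then ∑_{i=1}^m n_i B_{n_i−1}(x_i) ∏_{j≠i} B_{n_j}(x_j) = ∑_{i=1}^m n_i ∑_{k_1+⋯+k_m = n_1+⋯+n_m, k_j≥0} B_{k_i−1}(x_i) ∏_{j≠i} C(n_j,k_j) B_{k_j}(x_j − x_i + 1_{j>i}), with the conventions B_{−1} := 0, 1_{j>i} = 1 if j>i and 0 otherwise, and C(n_j,k_j) = 0 when k_j > n_j. -/

import Mathlib

/-- The `n`-th Bernoulli polynomial evaluated at a complex number. -/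
noncomputable def Bp (n : ℕ) (x : ℂ) : ℂ := Polynomial.aeval x (Polynomial.bernoulli n)

open Polynomial

noncomputable def cgB (n : ℕ) : ℂ[X] := (Polynomial.bernoulli n).map (algebraMap ℚ ℂ)

theorem cgB_eval (n : ℕ) (x : ℂ) : (cgB n).eval x = Bp n x := by
  simp [cgB, Bp, Polynomial.aeval_def, Polynomial.eval_map]

noncomputable def cgL : ℂ[X] →ₗ[ℂ] ℂ := Polynomial.lsum (fun n => (LinearMap.mulRight ℂ (Bp n 0)))

theorem cgL_X_pow (n : ℕ) : cgL (X ^ n) = Bp n 0 := by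
  simp [cgL, Polynomial.lsum_apply, ← Polynomial.monomial_one_right_eq_X_pow]

theorem Bp_zero (n : ℕ) : Bp n 0 = ((_root_.bernoulli n : ℚ) : ℂ) := by
  rw [← cgB_eval]
  simp [cgB, Polynomial.eval_map, Polynomial.eval₂_at_zero, Polynomial.coeff_zero_eq_eval_zero]

theorem Bp_eq_sum (n : ℕ) (a : ℂ) :
    Bp n a = ∑ k ∈ Finset.range (n + 1), Bp k 0 * a ^ (n - k) * (n.choose k : ℂ) := by
  simp only [Bp_zero]
  rw [Bp, Polynomial.bernoulli_def, map_sum]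
  rw [← Finset.sum_range_reflect]
  refine Finset.sum_congr rfl fun k hk => ?_
  have hk' : k ≤ n := by simpa [Nat.lt_succ_iff] using hk
  simp only [Polynomial.aeval_monomial]
  have e : n + 1 - 1 - k = n - k := by omega
  have e2 : n - (n - k) = k := by omega
  rw [e, e2, Nat.choose_symm hk']
  simp; ring

theorem cgL_pow (n : ℕ) (a : ℂ) : cgL ((X + C a) ^ n) = Bp n a := by
  rw [add_pow, map_sum, Bp_eq_sum]
  refine Finset.sum_congr rfl fun k _ => ?_
  have : (X ^ k * C a ^ (n - k) * ((n.choose k : ℕ) : ℂ[X])) = (a ^ (n-k) * (n.choose k : ℂ)) • X ^ k := by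
    rw [Polynomial.smul_eq_C_mul]; simp; ring
  rw [this, map_smul, cgL_X_pow, smul_eq_mul]; ring

theorem Bp_add (n : ℕ) (u v : ℂ) :
    Bp n (u + v) = ∑ k ∈ Finset.range (n + 1), (n.choose k : ℂ) * Bp k u * v ^ (n - k) := by
  rw [← cgL_pow, C_add, ← add_assoc, add_pow, map_sum]
  refine Finset.sum_congr rfl fun k _ => ?_
  have : ((X + C u) ^ k * C v ^ (n - k) * ((n.choose k : ℕ) : ℂ[X])) = (v ^ (n-k) * (n.choose k : ℂ)) • (X + C u) ^ k := by
    rw [Polynomial.smul_eq_C_mul]; simp; ring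
  rw [this, map_smul, cgL_pow, smul_eq_mul]; ring

theorem Bp_add_one (n : ℕ) (x : ℂ) : Bp n (x + 1) = Bp n x + n * x ^ (n - 1) := by
  have h := congrArg (Polynomial.aeval x) (Polynomial.bernoulli_comp_one_add_X n)
  rw [Polynomial.aeval_comp] at h
  simp only [Bp]
  rw [add_comm x 1]
  simpa using h

theorem cgL_shift (p : ℂ[X]) : cgL (p.comp (X + 1) - p) = p.derivative.eval 0 := by
  induction p using Polynomial.induction_on' with
  | add p q hp hq =>
    rw [Polynomial.add_comp, derivative_add, eval_add, ← hp, ← hq, ← map_add]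
    congr 1; ring
  | monomial n a =>
    have h1 := cgL_pow n 1
    rw [← zero_add (1 : ℂ), Bp_add_one] at h1
    rw [map_sub, ← C_mul_X_pow_eq_monomial, ← smul_eq_C_mul, smul_comp, map_smul, map_smul, X_pow_comp,
      cgL_X_pow]
    simp only [zero_add, map_one] at h1
    rw [h1]
    simp [Polynomial.derivative_X_pow]
    ring

theorem Bp_deriv (n : ℕ) (x c : ℂ) :
    (derivative ((cgB n).comp (X + C c))).eval x = n * Bp (n - 1) (x + c) := by
  rw [derivative_comp]
  simp only [cgB, Polynomial.derivative_map, Polynomial.derivative_bernoulli]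
  simp [eval_mul, eval_comp, Bp, aeval_def, eval_map]

theorem cg_expand (m : ℕ) (n : Fin m → ℕ) (hn : ∀ i, 0 < n i) (i : Fin m)
    (a : ℂ) (w : Fin m → ℕ → ℂ) :
    ∑ k ∈ Finset.Nat.antidiagonalTuple m (∑ j, n j),
        (if k i = 0 then 0 else Bp (k i - 1) a) *
          ∏ j ∈ Finset.univ.erase i, ((n j).choose (k j) : ℂ) * w j (k j) =
    cgL ((X + C a) ^ (n i - 1) * ∏ j ∈ Finset.univ.erase i,
      ∑ k ∈ Finset.range (n j + 1), C ((n j).choose k * w j k) * (X + C a) ^ (n j - k)) := by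
  classical
  have key : ∏ j ∈ Finset.univ.erase i,
      ∑ k ∈ Finset.range (n j + 1), C (((n j).choose k : ℂ) * w j k) * (X + C a) ^ (n j - k) =
      ∑ k ∈ Fintype.piFinset (fun j => if j = i then {0} else Finset.range (n j + 1)),
        ∏ j ∈ Finset.univ.erase i,
          (C (((n j).choose (k j) : ℂ) * w j (k j)) * (X + C a) ^ (n j - k j)) := by
    have h := Finset.prod_univ_sum (fun j => if j = i then {0} else Finset.range (n j + 1))
      (fun j k => if j = i then (1 : ℂ[X]) else
        C (((n j).choose k : ℂ) * w j k) * (X + C a) ^ (n j - k))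
    rw [← Finset.mul_prod_erase Finset.univ _ (Finset.mem_univ i)] at h
    simp only [if_true, Finset.sum_singleton, one_mul] at h
    refine Eq.trans ?_ (h.trans ?_)
    · refine Finset.prod_congr rfl fun j hj => ?_
      simp [Finset.ne_of_mem_erase hj]
    · refine Finset.sum_congr rfl fun k _ => ?_
      rw [← Finset.mul_prod_erase Finset.univ _ (Finset.mem_univ i)]
      simp only [if_true, one_mul]
      refine Finset.prod_congr rfl fun j hj => ?_
      simp [Finset.ne_of_mem_erase hj]
  rw [key, Finset.mul_sum, map_sum]
  rw [← Finset.sum_filter_of_ne (p := fun k : Fin m → ℕ => ∀ j ≠ i, k j ≤ n j)]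
  swap
  · intro k _ hk j hj
    by_contra hlt
    apply hk
    rw [Finset.prod_eq_zero (i := j) (by simp [hj]), mul_zero]
    rw [Nat.choose_eq_zero_of_lt (by omega)]; simp
  have hN := Finset.add_sum_erase Finset.univ n (Finset.mem_univ i)
  have hup : ∀ (k : Fin m → ℕ) c, ∑ j ∈ Finset.univ.erase i, Function.update k i c j =
      ∑ j ∈ Finset.univ.erase i, k j := fun k c => Finset.sum_congr rfl fun j hj => by
        simp [Finset.ne_of_mem_erase hj]
  refine Finset.sum_bij' (fun k _ => Function.update k i 0)
    (fun k _ => Function.update k i (∑ j, n j - ∑ j ∈ Finset.univ.erase i, k j)) ?_ ?_ ?_ ?_ ?_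
  · intro k hk
    simp only [Finset.mem_filter] at hk
    rw [Fintype.mem_piFinset]
    intro j
    by_cases hj : j = i
    · subst hj; simp
    · simpa [hj, Nat.lt_succ_iff] using hk.2 j hj
  · intro k hk
    rw [Fintype.mem_piFinset] at hk
    have hk' : ∀ j ≠ i, k j ≤ n j := fun j hj => by
      simpa [hj, Nat.lt_succ_iff] using hk j
    have hle : ∑ j ∈ Finset.univ.erase i, k j ≤ ∑ j ∈ Finset.univ.erase i, n j :=
      Finset.sum_le_sum fun j hj => hk' j (Finset.ne_of_mem_erase hj)
    rw [Finset.mem_filter, Finset.Nat.mem_antidiagonalTuple]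
    constructor
    · rw [← Finset.add_sum_erase Finset.univ _ (Finset.mem_univ i), hup]
      simp only [Function.update_self]
      omega
    · intro j hj; simpa [hj] using hk' j hj
  · intro k hk
    rw [Finset.mem_filter, Finset.Nat.mem_antidiagonalTuple] at hk
    have := Finset.add_sum_erase Finset.univ k (Finset.mem_univ i)
    simp only [hup, Function.update_idem]
    rw [Function.update_eq_self_iff]
    omega
  · intro k hk
    rw [Fintype.mem_piFinset] at hk
    have := hk i
    simp only [Function.update_idem]
    rw [Function.update_eq_self_iff]
    simp only [if_true, Finset.mem_singleton] at this
    exact this.symm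
  · intro k hk
    rw [Finset.mem_filter, Finset.Nat.mem_antidiagonalTuple] at hk
    obtain ⟨hs, hk⟩ := hk
    have h1 := Finset.add_sum_erase Finset.univ k (Finset.mem_univ i)
    have hle : ∑ j ∈ Finset.univ.erase i, (n j - k j) + ∑ j ∈ Finset.univ.erase i, k j
        = ∑ j ∈ Finset.univ.erase i, n j := by
      rw [← Finset.sum_add_distrib]
      refine Finset.sum_congr rfl fun j hj => ?_
      have := hk j (Finset.ne_of_mem_erase hj)
      omega
    have hi := hn i
    have e : ∏ j ∈ Finset.univ.erase i,
          (C (((n j).choose (Function.update k i 0 j) : ℂ) * w j (Function.update k i 0 j)) *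
            (X + C a) ^ (n j - Function.update k i 0 j)) =
        ∏ j ∈ Finset.univ.erase i,
          (C (((n j).choose (k j) : ℂ) * w j (k j)) * (X + C a) ^ (n j - k j)) :=
      Finset.prod_congr rfl fun j hj => by
        rw [Function.update_of_ne (Finset.ne_of_mem_erase hj)]
    rw [e, Finset.prod_mul_distrib (f := fun j => C (((n j).choose (k j) : ℂ) * w j (k j))), Finset.prod_pow_eq_pow_sum, ← map_prod, mul_left_comm, ← pow_add,
      ← smul_eq_C_mul, map_smul, cgL_pow, smul_eq_mul, if_neg (by omega), mul_comm]
    congr 2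
    omega

theorem carlitz_generalized (m : ℕ) (hm : 0 < m) (n : Fin m → ℕ) (hn : ∀ i, 0 < n i)
    (x : Fin m → ℂ) :
    ∑ i, (n i : ℂ) * Bp (n i - 1) (x i) * ∏ j ∈ Finset.univ.erase i, Bp (n j) (x j) =
    ∑ i, (n i : ℂ) *
      ∑ k ∈ Finset.Nat.antidiagonalTuple m (∑ j, n j),
        (if k i = 0 then 0 else Bp (k i - 1) (x i)) *
          ∏ j ∈ Finset.univ.erase i,
            ((n j).choose (k j) : ℂ) * Bp (k j) (x j - x i + if i < j then 1 else 0) := by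
  classical
  set P : ℂ[X] := ∏ j, (cgB (n j)).comp (X + C (x j)) with hP
  have hL : P.derivative.eval 0 =
      ∑ i, (n i : ℂ) * Bp (n i - 1) (x i) * ∏ j ∈ Finset.univ.erase i, Bp (n j) (x j) := by
    rw [hP, Polynomial.derivative_prod_finset, eval_finsetSum]
    refine Finset.sum_congr rfl fun i _ => ?_
    rw [eval_mul, Bp_deriv, eval_prod, mul_comm]
    simp [eval_comp, cgB_eval]
  rw [← hL, ← cgL_shift]
  have htel : P.comp (X + 1) - P = ∑ i, (C (n i : ℂ) * (X + C (x i)) ^ (n i - 1)) *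
      ∏ j ∈ Finset.univ.erase i,
        (cgB (n j)).comp (X + C (x j + if i < j then 1 else 0)) := by
    apply Polynomial.funext
    intro s
    have h := Finset.prod_add_ordered Finset.univ (fun j => Bp (n j) (s + x j + 1))
      (fun j => Bp (n j) (s + x j) - Bp (n j) (s + x j + 1))
    simp only [add_sub_cancel] at h
    have h2 : (P.comp (X + 1) - P).eval s =
        ∏ j, Bp (n j) (s + x j + 1) - ∏ j, Bp (n j) (s + x j) := by
      simp only [hP, eval_sub, eval_comp, eval_prod, cgB_eval, eval_add, eval_X, eval_C, eval_one]
      congr 1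
      refine Finset.prod_congr rfl fun j _ => ?_
      congr 1; ring
    rw [h2, h, eval_finsetSum, sub_add_cancel_left, ← Finset.sum_neg_distrib]
    refine Finset.sum_congr rfl fun i _ => ?_
    have h3 : ∏ j ∈ Finset.univ.erase i, Bp (n j) (s + (x j + if i < j then 1 else 0)) =
        (∏ j with j < i, Bp (n j) (s + x j)) * ∏ j with i < j, Bp (n j) (s + x j + 1) := by
      rw [← Finset.prod_filter_mul_prod_filter_not (Finset.univ.erase i) (fun j => j < i)]
      congr 1
      · refine Finset.prod_congr ?_ ?_
        · ext j; simp; intro h; exact h.ne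
        · intro j hj
          have : j < i := (Finset.mem_filter.mp hj).2
          rw [if_neg this.not_gt, add_zero]
      · refine Finset.prod_congr ?_ ?_
        · ext j; simp only [Finset.mem_filter, Finset.mem_erase, Finset.mem_univ, and_true, true_and, not_lt]
          exact ⟨fun h => lt_of_le_of_ne h.2 (Ne.symm h.1), fun h => ⟨h.ne', h.le⟩⟩
        · intro j hj
          have : i < j := (Finset.mem_filter.mp hj).2
          simp [this, add_assoc]
    simp only [eval_mul, eval_prod, eval_comp, cgB_eval, eval_add, eval_X, eval_C, eval_pow]
    rw [h3, Bp_add_one (n i) (s + x i)]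
    ring
  rw [htel, map_sum]
  refine Finset.sum_congr rfl fun i _ => ?_
  rw [cg_expand m n hn i (x i) (fun j k => Bp k (x j - x i + if i < j then 1 else 0)),
    mul_assoc, ← smul_eq_C_mul, map_smul, smul_eq_mul]
  congr 3
  refine Finset.prod_congr rfl fun j _ => ?_
  apply Polynomial.funext
  intro s
  simp only [eval_finsetSum, eval_mul, eval_comp, cgB_eval, eval_add, eval_X, eval_C, eval_pow]
  rw [← Bp_add]
  congr 1; ring
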